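/- arXiv:2505.24565 — 2 statements merged into one kernel-verified Lean document; each statement's English description precedes it below -/
import Mathlib

section
/- Fix an integer ℓ ≥ 1. For a natural number c, let A(c) be the number of primes p with 3 ≤ p ≤ c such that the polynomial z^(p^ℓ) − z + c has exactly p roots z in ℤ/pℤ (with c reduced modulo p), and let B(c) be the number of primes p with 3 ≤ p ≤ c. Then the real-valued ratio A(c)/B(c) tends to 0 as c tends to infinity. -/
theorem Nat.two_pow_card_primeFactors_le {n : ℕ} (hn : n ≠ 0) : 2 ^ n.primeFactors.card ≤ n :=
  (Finset.pow_card_le_prod _ _ _ fun _ hp => (Nat.prime_of_mem_primeFactors hp).two_le).trans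
    (Nat.le_of_dvd hn.bot_lt n.prod_primeFactors_dvd)

theorem Nat.card_primeFactors_le_two_mul_log {n : ℕ} (hn : n ≠ 0) :
    (n.primeFactors.card : ℝ) ≤ 2 * Real.log n := by
  have h : Real.log ((2 : ℝ) ^ n.primeFactors.card) ≤ Real.log n :=
    Real.log_le_log (by positivity) (mod_cast Nat.two_pow_card_primeFactors_le hn)
  rw [Real.log_pow] at h
  nlinarith [Real.log_two_gt_d9,
    Nat.cast_nonneg (α := ℝ) n.primeFactors.card]

/-- By Fermat's little theorem, `z ^ p ^ ℓ - z + c` is the constant `c` modulo `p`, so it can have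
a root only if `p` divides `c`. -/
theorem dvd_of_exists_pow_card_pow_sub_add_eq_zero {p ℓ c : ℕ} (hp : p.Prime)
    (h : ∃ z : ZMod p, z ^ p ^ ℓ - z + (c : ZMod p) = 0) : p ∣ c := by
  have := Fact.mk hp
  obtain ⟨z, hz⟩ := h
  rw [ZMod.pow_card_pow, sub_self, zero_add] at hz
  exact (ZMod.natCast_eq_zero_iff c p).mp hz

open scoped Classical in
theorem Nat.primeCounting_le_card_filter_odd_prime_add_one (n : ℕ) :
    n.primeCounting ≤ ((Finset.range (n + 1)).filter (fun p => p.Prime ∧ 3 ≤ p)).card + 1 := by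
  rw [← Nat.primesLE_card_eq_primeCounting]
  refine (Finset.card_le_card fun p hp => ?_).trans (Finset.card_insert_le 2 _)
  have hpp := Nat.prime_of_mem_primesLE hp
  have hle : p ≤ n := Nat.le_of_mem_primesLE hp
  have := hpp.two_le
  simp only [Finset.mem_insert, Finset.mem_filter, Finset.mem_range]
  by_cases h : p = 2
  · exact Or.inl h
  · exact Or.inr ⟨by omega, hpp, by omega⟩

open Filter in
theorem Nat.eventually_div_log_le_primeCounting_sub_one :
    ∀ᶠ n : ℕ in atTop, (n : ℝ) / (4 * Real.log n) ≤ n.primeCounting - 1 := by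
  have hlog := (Real.isLittleO_log_id_atTop.comp_tendsto
    (tendsto_natCast_atTop_atTop (R := ℝ))).bound (show (0 : ℝ) < 1 / 10 by norm_num)
  filter_upwards [hlog, eventually_ge_atTop 2] with n hn h2
  have h2' : (2 : ℝ) ≤ n := mod_cast h2
  have hL : 0 < Real.log n := Real.log_pos (by linarith)
  simp only [Function.comp_apply, id, Real.norm_eq_abs, abs_of_pos hL, Nat.abs_cast] at hn
  have hsucc : Real.log (n + 1) ≤ 2 * Real.log n := by
    rw [← Nat.cast_ofNat, ← Real.log_pow]
    exact Real.log_le_log (by positivity) (by nlinarith)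
  have hpi := Chebyshev.pi_ge n
  rw [div_le_iff₀ hL] at hpi
  rw [div_le_iff₀ (by positivity)]
  nlinarith [Real.log_two_gt_d9]

open scoped Classical in
theorem stmt_16 (ℓ : ℕ) (hℓ : 1 ≤ ℓ) :
    Filter.Tendsto (fun c : ℕ =>
      ((((Finset.range (c + 1)).filter (fun p =>
          p.Prime ∧ 3 ≤ p ∧
          Nat.card {z : ZMod p // z ^ (p ^ ℓ) - z + (c : ZMod p) = 0} = p)).card : ℝ) /
        (((Finset.range (c + 1)).filter (fun p => p.Prime ∧ 3 ≤ p)).card : ℝ)))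
      Filter.atTop (nhds 0) := by
  have hlim : Filter.Tendsto (fun c : ℕ => 8 * (Real.log c ^ 2 / c)) Filter.atTop (nhds 0) := by
    simpa using ((Real.isLittleO_pow_log_id_atTop (n := 2)).tendsto_div_nhds_zero.comp
      (tendsto_natCast_atTop_atTop (R := ℝ))).const_mul 8
  refine squeeze_zero' (.of_forall fun c => by positivity) ?_ hlim
  filter_upwards [Nat.eventually_div_log_le_primeCounting_sub_one,
    Filter.eventually_ge_atTop 2] with c hc h2
  have hL : 0 < Real.log c := Real.log_pos (mod_cast h2)
  have hc0 : (0 : ℝ) < c := by positivity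
  have hnum : (Finset.range (c + 1)).filter (fun p => p.Prime ∧ 3 ≤ p ∧
      Nat.card {z : ZMod p // z ^ (p ^ ℓ) - z + (c : ZMod p) = 0} = p) ⊆ c.primeFactors := by
    intro p hp
    obtain ⟨-, hpp, -, hcard⟩ := Finset.mem_filter.mp hp
    have hne := (Nat.card_pos_iff.mp (hcard.symm ▸ hpp.pos)).1
    exact Nat.mem_primeFactors.mpr ⟨hpp,
      dvd_of_exists_pow_card_pow_sub_add_eq_zero hpp (nonempty_subtype.mp hne), by omega⟩
  have hden : (c : ℝ) / (4 * Real.log c) ≤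
      ((Finset.range (c + 1)).filter (fun p => p.Prime ∧ 3 ≤ p)).card := by
    have : (c.primeCounting : ℝ) ≤ _ :=
      Nat.cast_le.mpr (Nat.primeCounting_le_card_filter_odd_prime_add_one c)
    push_cast at this
    linarith
  calc _ ≤ (2 * Real.log c) / (c / (4 * Real.log c)) :=
        div_le_div₀ (by positivity)
          ((Nat.cast_le.mpr (Finset.card_le_card hnum)).trans
            (Nat.card_primeFactors_le_two_mul_log (by omega))) (by positivity) hden
    _ = 8 * (Real.log c ^ 2 / c) := by field_simp; ring
end

section
/- Fix an integer ℓ ≥ 1. For a natural number c, let A(c) be the number of primes p with 5 ≤ p ≤ c such that the polynomial z^((p−1)^ℓ) − z + c has exactly 2 roots z in ℤ/pℤ (with c reduced modulo p), and let B(c) be the number of primes p with 5 ≤ p ≤ c. Then the real-valued ratio A(c)/B(c) tends to 0 as c tends to infinity. -/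
/-- By Fermat's little theorem, two fixed points modulo `p` force `p ∣ c`. -/
theorem dvd_of_natCard_fixedPoints_eq_two {p : ℕ} (hp : p.Prime) (ℓ c : ℕ) (hℓ : 1 ≤ ℓ)
    (h : Nat.card {z : ZMod p // z ^ ((p - 1) ^ ℓ) - z + (c : ZMod p) = 0} = 2) : p ∣ c := by
  have : Fact p.Prime := ⟨hp⟩
  rw [← ZMod.natCast_eq_zero_iff]
  by_contra hc
  have eq_one_add (z : ZMod p) (hz : z ^ ((p - 1) ^ ℓ) - z + (c : ZMod p) = 0) :
      z = 1 + c := by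
    have hexp : (p - 1) ^ ℓ ≠ 0 := pow_ne_zero _ (Nat.sub_ne_zero_of_lt hp.one_lt)
    have hz0 : z ≠ 0 := by
      rintro rfl
      simp [zero_pow hexp, hc] at hz
    obtain ⟨k, hk⟩ : p - 1 ∣ (p - 1) ^ ℓ := dvd_pow_self _ (by omega)
    rw [hk, pow_mul, ZMod.pow_card_sub_one_eq_one hz0, one_pow] at hz
    linear_combination -hz
  have : Subsingleton {z : ZMod p // z ^ ((p - 1) ^ ℓ) - z + (c : ZMod p) = 0} :=
    ⟨fun x y ↦ Subtype.ext ((eq_one_add x x.2).trans (eq_one_add y y.2).symm)⟩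
  have := Finite.card_le_one_iff_subsingleton.mpr this
  omega

theorem card_primeFactors_le_log_div_log_two {n : ℕ} (hn : n ≠ 0) :
    (n.primeFactors.card : ℝ) ≤ Real.log n / Real.log 2 := by
  have hpow : 2 ^ n.primeFactors.card ≤ n :=
    (Finset.pow_card_le_prod _ _ _ fun p hp ↦ (Nat.prime_of_mem_primeFactors hp).two_le).trans
      (Nat.le_of_dvd (Nat.pos_of_ne_zero hn) (Nat.prod_primeFactors_dvd n))
  rw [le_div_iff₀ (Real.log_pos one_lt_two), ← Real.log_pow]
  exact Real.log_le_log (by positivity) (mod_cast hpow)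

theorem primeCounting_le_card_primes_ge_five_add_two (n : ℕ) :
    n.primeCounting ≤ ((Finset.range (n + 1)).filter (fun p => p.Prime ∧ 5 ≤ p)).card + 2 := by
  rw [← Nat.primesLE_card_eq_primeCounting]
  have hsub : n.primesLE ⊆
      (Finset.range (n + 1)).filter (fun p => p.Prime ∧ 5 ≤ p) ∪ {2, 3} := by
    intro p hp
    rw [Nat.mem_primesLE] at hp
    simp only [Finset.mem_union, Finset.mem_filter, Finset.mem_range, Finset.mem_insert,
      Finset.mem_singleton]
    by_cases h5 : 5 ≤ p
    · exact Or.inl ⟨by omega, hp.2, h5⟩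
    · have := hp.2.two_le
      have : p ≠ 4 := by
        rintro rfl
        exact absurd hp.2 (by norm_num)
      omega
  exact (Finset.card_le_card hsub).trans (Finset.card_union_le _ _)

/-- A Chebyshev-type lower bound for the number of primes in `[5, n]`. -/
theorem eventually_div_log_le_card_primes_ge_five :
    ∀ᶠ n : ℕ in Filter.atTop, (n : ℝ) / (4 * Real.log n) ≤
      ((Finset.range (n + 1)).filter (fun p => p.Prime ∧ 5 ≤ p)).card := by
  have hlog := (Real.isLittleO_log_id_atTop.bound (show (0 : ℝ) < 1 / 10 by norm_num))
  filter_upwards [tendsto_natCast_atTop_atTop.eventually hlog, Filter.eventually_ge_atTop 2]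
    with n hn hn2
  have hn2' : (2 : ℝ) ≤ n := mod_cast hn2
  have hpos : 0 < Real.log n := Real.log_pos (by linarith)
  rw [Real.norm_of_nonneg hpos.le, id, Real.norm_of_nonneg (by linarith)] at hn
  have hsucc : Real.log (n + 1) ≤ 2 * Real.log n := by
    rw [← Real.log_rpow (by linarith), Real.rpow_two]
    exact Real.log_le_log (by linarith) (by nlinarith)
  have hpi := Chebyshev.pi_ge n
  have hcard : (n.primeCounting : ℝ) ≤
      ((Finset.range (n + 1)).filter (fun p => p.Prime ∧ 5 ≤ p)).card + 2 :=
    mod_cast primeCounting_le_card_primes_ge_five_add_two n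
  have hbound := hpi.trans hcard
  rw [div_le_iff₀ hpos] at hbound
  rw [div_le_iff₀ (by positivity)]
  have h2 := Real.log_two_gt_d9
  nlinarith

open scoped Classical in
theorem stmt_18 (ℓ : ℕ) (hℓ : 1 ≤ ℓ) :
    Filter.Tendsto (fun c : ℕ =>
      ((((Finset.range (c + 1)).filter (fun p =>
          p.Prime ∧ 5 ≤ p ∧
          Nat.card {z : ZMod p // z ^ ((p - 1) ^ ℓ) - z + (c : ZMod p) = 0} = 2)).card : ℝ) /
        (((Finset.range (c + 1)).filter (fun p => p.Prime ∧ 5 ≤ p)).card : ℝ)))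
      Filter.atTop (nhds 0) := by
  have hlim : Filter.Tendsto
      (fun c : ℕ ↦ 4 / Real.log 2 * (Real.log c ^ 2 / (c : ℝ))) Filter.atTop (nhds 0) := by
    simpa using ((Real.isLittleO_pow_log_id_atTop (n := 2)).tendsto_div_nhds_zero.comp
      tendsto_natCast_atTop_atTop).const_mul (4 / Real.log 2)
  refine squeeze_zero' (Filter.Eventually.of_forall fun c ↦ by positivity) ?_ hlim
  filter_upwards [eventually_div_log_le_card_primes_ge_five, Filter.eventually_ge_atTop 2]
    with c hden hc
  have hc2 : (2 : ℝ) ≤ c := mod_cast hc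
  have hlogc : 0 < Real.log c := Real.log_pos (by linarith)
  have hlog2 : 0 < Real.log 2 := Real.log_pos one_lt_two
  have hnum : (((Finset.range (c + 1)).filter (fun p =>
      p.Prime ∧ 5 ≤ p ∧
      Nat.card {z : ZMod p // z ^ ((p - 1) ^ ℓ) - z + (c : ZMod p) = 0} = 2)).card : ℝ) ≤
      Real.log c / Real.log 2 := by
    refine le_trans ?_ (card_primeFactors_le_log_div_log_two (by omega : c ≠ 0))
    refine Nat.cast_le.mpr (Finset.card_le_card fun p hp ↦ ?_)
    rw [Finset.mem_filter] at hp
    exact Nat.mem_primeFactors.mpr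
      ⟨hp.2.1, dvd_of_natCard_fixedPoints_eq_two hp.2.1 ℓ c hℓ hp.2.2.2, by omega⟩
  calc
    _ ≤ (Real.log c / Real.log 2) / (c / (4 * Real.log c)) := by
      refine div_le_div₀ (by positivity) hnum (by positivity) ?_
      convert hden
    _ = _ := by
      field_simp
end
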